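/- Let n ≥ 3 be an odd integer with n ≠ 3. Then the number of MSTD subsets of the dicyclic group Dic_{4n} of cardinality 3 is strictly greater than the number of MDTS subsets of Dic_{4n} of cardinality 3, i.e., S_{Dic_{4n}}(3) > D_{Dic_{4n}}(3). -/

import Mathlib

open Finset Pointwise

/-- A finset of a group is MSTD if its sumset `A * A` is larger than its
difference set `A / A = {a₁ * a₂⁻¹}`. -/
def IsMSTD {G : Type*} [Group G] [DecidableEq G] (A : Finset G) : Prop :=
  (A / A).card < (A * A).card

/-- A finset of a group is MDTS if its sumset is smaller than its difference set. -/
def IsMDTS {G : Type*} [Group G] [DecidableEq G] (A : Finset G) : Prop :=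
  (A * A).card < (A / A).card

/-- A finset of a group is balanced if its sumset and difference set have equal size. -/
def IsBalanced {G : Type*} [Group G] [DecidableEq G] (A : Finset G) : Prop :=
  (A * A).card = (A / A).card

namespace QuaternionGroup

variable {n : ℕ}

theorem natCast_add_self_eq_zero : (n : ZMod (2 * n)) + n = 0 := by
  have h := ZMod.natCast_self (2 * n)
  rwa [Nat.cast_mul, Nat.cast_two, two_mul (n : ZMod (2 * n))] at h

theorem natCast_ne_zero_of_pos (hn : 0 < n) : (n : ZMod (2 * n)) ≠ 0 := by
  rw [Ne, ZMod.natCast_eq_zero_iff]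
  intro h
  have := Nat.le_of_dvd hn h
  omega

theorem eq_zero_or_eq_natCast_of_add_self (hn : 0 < n) {z : ZMod (2 * n)} (hz : z + z = 0) :
    z = 0 ∨ z = n := by
  have : NeZero (2 * n) := ⟨by omega⟩
  obtain ⟨k, hk, rfl⟩ : ∃ k < 2 * n, (k : ZMod (2 * n)) = z :=
    ⟨z.val, z.val_lt, ZMod.natCast_zmod_val z⟩
  have h : 2 * n ∣ 2 * k := by
    rwa [← ZMod.natCast_eq_zero_iff, two_mul k, Nat.cast_add]
  obtain ⟨q, rfl⟩ := Nat.dvd_of_mul_dvd_mul_left two_pos h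
  have hq : q < 2 := by
    by_contra! hq
    nlinarith
  interval_cases q <;> simp

theorem add_self_ne_natCast (hodd : Odd n) (z : ZMod (2 * n)) : z + z ≠ n := by
  intro h
  have h' := congrArg (ZMod.castHom (dvd_mul_right 2 n) (ZMod 2)) h
  rw [map_add, CharTwo.add_self_eq_zero, map_natCast, eq_comm, ZMod.natCast_eq_zero_iff] at h'
  exact (Nat.not_even_iff_odd.2 hodd) (even_iff_two_dvd.2 h')

theorem inv_a (i : ZMod (2 * n)) : (a i)⁻¹ = a (-i) :=
  inv_eq_of_mul_eq_one_right (by simp)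

theorem inv_xa (i : ZMod (2 * n)) : (xa i)⁻¹ = xa ((n : ZMod (2 * n)) + i) := by
  refine inv_eq_of_mul_eq_one_right ?_
  have h := natCast_add_self_eq_zero (n := n)
  rw [xa_mul_xa, one_def]
  congr 1
  linear_combination h

theorem length_le_card {α : Type*} [DecidableEq α] {l : List α} (hl : l.Nodup) {s : Finset α}
    (h : l.toFinset ⊆ s) : l.length ≤ s.card :=
  List.toFinset_card_of_nodup hl ▸ card_le_card h

theorem card_le_length {α : Type*} [DecidableEq α] {l : List α} {s : Finset α}
    (h : s ⊆ l.toFinset) : s.card ≤ l.length :=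
  (card_le_card h).trans l.toFinset_card_le

theorem mul_aax (u v x : ZMod (2 * n)) :
    ({a u, a v, xa x} * {a u, a v, xa x} : Finset (QuaternionGroup n)) =
      {a (u + u), a (u + v), a (v + v), a (n : ZMod (2 * n)), xa (x - u), xa (x - v), xa (x + u),
          xa (x + v)} := by
  ext z
  simp only [mem_mul, mem_insert, mem_singleton, exists_eq_or_imp, exists_eq_left, a_mul_a,
    a_mul_xa, xa_mul_a, xa_mul_xa, add_sub_cancel_right, add_comm v u]
  grind

theorem div_aax (u v x : ZMod (2 * n)) :
    ({a u, a v, xa x} / {a u, a v, xa x} : Finset (QuaternionGroup n)) =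
      {a 0, a (u - v), a (v - u), xa (x - u), xa (x - v), xa ((n : ZMod (2 * n)) + x - u),
          xa ((n : ZMod (2 * n)) + x - v)} := by
  have h := natCast_add_self_eq_zero (n := n)
  ext z
  simp only [mem_div, mem_insert, mem_singleton, exists_eq_or_imp, exists_eq_left]
  simp only [a_mul_a, a_mul_xa, xa_mul_a, xa_mul_xa, div_eq_mul_inv, inv_a, inv_xa]
  grind

theorem mul_axx (i x y : ZMod (2 * n)) :
    ({a i, xa x, xa y} * {a i, xa x, xa y} : Finset (QuaternionGroup n)) =
      {a (i + i), a (n : ZMod (2 * n)), a ((n : ZMod (2 * n)) + x - y),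
          a ((n : ZMod (2 * n)) + y - x),
        xa (x - i), xa (y - i), xa (x + i), xa (y + i)} := by
  ext z
  simp only [mem_mul, mem_insert, mem_singleton, exists_eq_or_imp, exists_eq_left, a_mul_a,
    a_mul_xa, xa_mul_a, xa_mul_xa, add_sub_cancel_right]
  grind

theorem div_axx (i x y : ZMod (2 * n)) :
    ({a i, xa x, xa y} / {a i, xa x, xa y} : Finset (QuaternionGroup n)) =
      {a 0, a (x - y), a (y - x), xa (x - i), xa (y - i), xa ((n : ZMod (2 * n)) + x - i),
          xa ((n : ZMod (2 * n)) + y - i)} := by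
  have h := natCast_add_self_eq_zero (n := n)
  ext z
  simp only [mem_div, mem_insert, mem_singleton, exists_eq_or_imp, exists_eq_left]
  simp only [a_mul_a, a_mul_xa, xa_mul_a, xa_mul_xa, div_eq_mul_inv, inv_a, inv_xa]
  grind

theorem card_div_aax_le (u v x : ZMod (2 * n)) :
    ({a u, a v, xa x} / {a u, a v, xa x} : Finset (QuaternionGroup n)).card ≤ 7 := by
  rw [div_aax]
  exact (card_insert_le _ _).trans (Nat.succ_le_succ card_le_six)

theorem card_div_axx_le (i x y : ZMod (2 * n)) :
    ({a i, xa x, xa y} / {a i, xa x, xa y} : Finset (QuaternionGroup n)).card ≤ 7 := by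
  rw [div_axx]
  exact (card_insert_le _ _).trans (Nat.succ_le_succ card_le_six)

theorem isMSTD_aax (hn : 0 < n) (hodd : Odd n) {u v x : ZMod (2 * n)}
    (hu : u ∉ ({0, (n : ZMod (2 * n))} : Finset _))
    (hv : v ∉ ({0, (n : ZMod (2 * n)), u, n + u, -u, n - u} : Finset _)) :
    IsMSTD ({a u, a v, xa x} : Finset (QuaternionGroup n)) := by
  refine (Nat.lt_succ_of_le (card_div_aax_le u v x)).trans_le ?_
  simp only [mem_insert, mem_singleton, not_or] at hu hv
  have h := natCast_add_self_eq_zero (n := n)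
  have h₁ := add_self_ne_natCast hodd u
  have h₂ := add_self_ne_natCast hodd v
  have h₃ := @eq_zero_or_eq_natCast_of_add_self n hn u
  have h₄ := @eq_zero_or_eq_natCast_of_add_self n hn v
  have h₅ := @eq_zero_or_eq_natCast_of_add_self n hn (u - v)
  refine length_le_card (l := [a (u + u), a (u + v), a (v + v), a (n : ZMod (2 * n)),
    xa (x - u), xa (x - v), xa (x + u), xa (x + v)]) ?_ (by rw [mul_aax]; simp)
  simp only [List.nodup_cons, List.mem_cons, not_or, reduceCtorEq, a.injEq, xa.injEq,
    List.not_mem_nil, List.nodup_nil, not_false_eq_true, and_true]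
  and_intros <;> first | trivial | (intro e; grind)

theorem isMSTD_axx (hn : 0 < n) (hodd : Odd n) {i x d : ZMod (2 * n)}
    (hi : i ∉ ({0, (n : ZMod (2 * n))} : Finset _))
    (hd : d ∉ ({0, (n : ZMod (2 * n)), i + i, -(i + i), n + (i + i), n - (i + i)} : Finset _)) :
    IsMSTD ({a i, xa x, xa (x + d)} : Finset (QuaternionGroup n)) := by
  refine (Nat.lt_succ_of_le (card_div_axx_le i x (x + d))).trans_le ?_
  simp only [mem_insert, mem_singleton, not_or] at hi hd
  have h := natCast_add_self_eq_zero (n := n)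
  have h₁ := add_self_ne_natCast hodd i
  have h₃ := @eq_zero_or_eq_natCast_of_add_self n hn i
  have h₅ := @eq_zero_or_eq_natCast_of_add_self n hn d
  refine length_le_card (l := [a (i + i), a (n : ZMod (2 * n)),
      a ((n : ZMod (2 * n)) + x - (x + d)),
    a ((n : ZMod (2 * n)) + (x + d) - x), xa (x - i), xa (x + d - i), xa (x + i), xa (x + d + i)])
        ?_ (by rw [mul_axx]; simp)
  simp only [List.nodup_cons, List.mem_cons, not_or, reduceCtorEq, a.injEq, xa.injEq,
    List.not_mem_nil, List.nodup_nil, not_false_eq_true, and_true]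
  and_intros <;> first | trivial | (intro e; grind)

theorem eq_neg_of_isMDTS_aax (hn : 0 < n) (hodd : Odd n) {u v x : ZMod (2 * n)}
    (huv : u ≠ v) (hA : IsMDTS ({a u, a v, xa x} : Finset (QuaternionGroup n))) :
    v = -u := by
  by_contra hs
  refine (not_le.2 hA) ?_
  have h := natCast_add_self_eq_zero (n := n)
  have h₀ := natCast_ne_zero_of_pos hn
  have h₁ := add_self_ne_natCast hodd u
  have h₂ := add_self_ne_natCast hodd v
  have h₃ := @eq_zero_or_eq_natCast_of_add_self n hn u
  have h₄ := @eq_zero_or_eq_natCast_of_add_self n hn v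
  have h₅ := @eq_zero_or_eq_natCast_of_add_self n hn (u - v)
  by_cases hd : u = n + v
  · refine (card_le_length (l := [a 0, a (n : ZMod (2 * n)), xa (x - u), xa (x - v)]) ?_).trans
      (length_le_card (l := [a (u + u), a (u + v), xa (x - u), xa (x - v)]) ?_ ?_)
    · rw [div_aax]
      intro z
      simp only [mem_insert, mem_singleton, List.mem_toFinset, List.mem_cons, List.not_mem_nil]
      rintro (rfl | rfl | rfl | rfl | rfl | rfl | rfl) <;>
        simp only [a.injEq, xa.injEq, reduceCtorEq, or_false, false_or] <;> grind
    · simp only [List.nodup_cons, List.mem_cons, not_or, reduceCtorEq, a.injEq, xa.injEq,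
        List.not_mem_nil, List.nodup_nil, not_false_eq_true, and_true]
      and_intros <;> first | trivial | (intro e; grind)
    · rw [mul_aax]
      simp [insert_subset_iff]
  refine (card_div_aax_le u v x).trans ?_
  rw [mul_aax]
  rcases eq_or_ne (u + v) n with hn' | hn'
  · refine length_le_card (l := [a (u + u), a (u + v), a (v + v),
      xa (x - u), xa (x - v), xa (x + u), xa (x + v)]) ?_ (by simp [insert_subset_iff])
    simp only [List.nodup_cons, List.mem_cons, not_or, reduceCtorEq, a.injEq, xa.injEq,
      List.not_mem_nil, List.nodup_nil, not_false_eq_true, and_true]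
    and_intros <;> first | trivial | (intro e; grind)
  rcases eq_or_ne (u + u) 0 with hu | hu
  · refine length_le_card (l := [a (u + u), a (u + v), a (v + v), a (n : ZMod (2 * n)),
      xa (x - u), xa (x - v), xa (x + v)]) ?_ (by simp [insert_subset_iff])
    simp only [List.nodup_cons, List.mem_cons, not_or, reduceCtorEq, a.injEq, xa.injEq,
      List.not_mem_nil, List.nodup_nil, not_false_eq_true, and_true]
    and_intros <;> first | trivial | (intro e; grind)
  · refine length_le_card (l := [a (u + u), a (u + v), a (v + v), a (n : ZMod (2 * n)),
      xa (x - u), xa (x - v), xa (x + u)]) ?_ (by simp [insert_subset_iff])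
    simp only [List.nodup_cons, List.mem_cons, not_or, reduceCtorEq, a.injEq, xa.injEq,
      List.not_mem_nil, List.nodup_nil, not_false_eq_true, and_true]
    and_intros <;> first | trivial | (intro e; grind)

theorem eq_zero_or_eq_natCast_of_isMDTS_axx (hn : 0 < n) (hodd : Odd n) {i x y : ZMod (2 * n)}
    (hxy : x ≠ y) (hA : IsMDTS ({a i, xa x, xa y} : Finset (QuaternionGroup n))) :
    i = 0 ∨ i = n := by
  by_contra hs
  refine (not_le.2 hA) ?_
  have h := natCast_add_self_eq_zero (n := n)
  have h₀ := natCast_ne_zero_of_pos hn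
  have h₁ := add_self_ne_natCast hodd i
  have h₂ := add_self_ne_natCast hodd (x - y)
  have h₃ := @eq_zero_or_eq_natCast_of_add_self n hn i
  have h₄ := @eq_zero_or_eq_natCast_of_add_self n hn (i + i)
  have h₅ := @eq_zero_or_eq_natCast_of_add_self n hn (x - y)
  by_cases hd : x = n + y
  · refine (card_le_length (l := [a 0, a (n : ZMod (2 * n)), xa (x - i), xa (y - i)]) ?_).trans
      (length_le_card (l := [a (n : ZMod (2 * n)), a ((n : ZMod (2 * n)) + x - y), xa (x - i),
          xa (y - i)]) ?_ ?_)
    · rw [div_axx]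
      intro z
      simp only [mem_insert, mem_singleton, List.mem_toFinset, List.mem_cons, List.not_mem_nil]
      rintro (rfl | rfl | rfl | rfl | rfl | rfl | rfl) <;>
        simp only [a.injEq, xa.injEq, reduceCtorEq, or_false, false_or] <;> grind
    · simp only [List.nodup_cons, List.mem_cons, not_or, reduceCtorEq, a.injEq, xa.injEq,
        List.not_mem_nil, List.nodup_nil, not_false_eq_true, and_true]
      and_intros <;> first | trivial | (intro e; grind)
    · rw [mul_axx]
      simp [insert_subset_iff]
  refine (card_div_axx_le i x y).trans ?_
  rw [mul_axx]
  rcases eq_or_ne (x - y) (i + i) with hi | hi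
  · refine length_le_card (l := [a (i + i), a (n : ZMod (2 * n)), a ((n : ZMod (2 * n)) + x - y),
        a ((n : ZMod (2 * n)) + y - x),
        xa (x - i), xa (y - i), xa (x + i)]) ?_ (by simp [insert_subset_iff])
    simp only [List.nodup_cons, List.mem_cons, not_or, reduceCtorEq, a.injEq, xa.injEq,
      List.not_mem_nil, List.nodup_nil, not_false_eq_true, and_true]
    and_intros <;> first | trivial | (intro e; grind)
  rcases eq_or_ne (y - x) (i + i) with hi' | hi'
  · refine length_le_card (l := [a (i + i), a (n : ZMod (2 * n)), a ((n : ZMod (2 * n)) + x - y),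
        a ((n : ZMod (2 * n)) + y - x),
        xa (x - i), xa (y - i), xa (y + i)]) ?_ (by simp [insert_subset_iff])
    simp only [List.nodup_cons, List.mem_cons, not_or, reduceCtorEq, a.injEq, xa.injEq,
      List.not_mem_nil, List.nodup_nil, not_false_eq_true, and_true]
    and_intros <;> first | trivial | (intro e; grind)
  · refine length_le_card (l := [a (n : ZMod (2 * n)), a ((n : ZMod (2 * n)) + x - y),
        a ((n : ZMod (2 * n)) + y - x),
        xa (x - i), xa (y - i), xa (x + i), xa (y + i)]) ?_ (by simp)
    simp only [List.nodup_cons, List.mem_cons, not_or, reduceCtorEq, a.injEq, xa.injEq,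
      List.not_mem_nil, List.nodup_nil, not_false_eq_true, and_true]
    and_intros <;> first | trivial | (intro e; grind)

theorem not_isMDTS_of_forall_xa {A : Finset (QuaternionGroup n)} (hA : ∀ g ∈ A, ∃ x, g = xa x) :
    ¬ IsMDTS A := by
  refine not_lt.2 ((card_le_card (t := (A * A).image (· * a (n : ZMod (2 * n))))
      fun z hz => ?_).trans card_image_le)
  obtain ⟨g, hg, k, hk, rfl⟩ := mem_div.1 hz
  refine mem_image.2 ⟨g * k, mul_mem_mul hg hk, ?_⟩
  obtain ⟨x, rfl⟩ := hA k hk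
  rw [mul_assoc, div_eq_mul_inv, inv_xa, xa_mul_a, add_comm]

theorem card_eq_three_cases {A : Finset (QuaternionGroup n)} (hA : A.card = 3) :
    (∀ g ∈ A, ∃ u, a u = g) ∨ (∃ u v x, u ≠ v ∧ A = {a u, a v, xa x}) ∨
      (∃ i x y, x ≠ y ∧ A = {a i, xa x, xa y}) ∨ ∀ g ∈ A, ∃ x, g = xa x := by
  obtain ⟨p, q, r, hpq, hpr, hqr, rfl⟩ := card_eq_three.1 hA
  rcases p with p | p <;> rcases q with q | q <;> rcases r with r | r
  · left; simp
  · exact .inr <| .inl ⟨p, q, r, by simpa using hpq, rfl⟩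
  · exact .inr <| .inl ⟨p, r, q, by simpa using hpr, by grind⟩
  · exact .inr <| .inr <| .inl ⟨p, q, r, by simpa using hqr, rfl⟩
  · exact .inr <| .inl ⟨q, r, p, by simpa using hqr, by grind⟩
  · exact .inr <| .inr <| .inl ⟨q, p, r, by simpa using hpr, by grind⟩
  · exact .inr <| .inr <| .inl ⟨r, p, q, by simpa using hpq, by grind⟩
  · right; right; right; simp

theorem ncard_isMDTS_le (hn : 0 < n) (hodd : Odd n) :
    {A : Finset (QuaternionGroup n) | A.card = 3 ∧ IsMDTS A}.ncard ≤
      (2 * n).choose 3 + (2 * n) * (2 * n) + 2 * (2 * n).choose 2 := by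
  have : NeZero (2 * n) := ⟨by omega⟩
  let s₁ := (univ.image (a : ZMod (2 * n) → QuaternionGroup n)).powersetCard 3
  let s₂ := (univ : Finset (ZMod (2 * n) × ZMod (2 * n))).image
    fun p => ({a p.1, a (-p.1), xa p.2} : Finset (QuaternionGroup n))
  let s₃ := (({0, (n : ZMod (2 * n))} : Finset _) ×ˢ
    (univ : Finset (ZMod (2 * n))).powersetCard 2).image
    fun p => insert (a p.1) (p.2.image xa)
  have hsub : {A : Finset (QuaternionGroup n) | A.card = 3 ∧ IsMDTS A} ⊆ ↑(s₁ ∪ s₂ ∪ s₃) := by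
    rintro A ⟨hA, hM⟩
    simp only [coe_union, Set.mem_union, mem_coe]
    obtain h | ⟨u, v, x, huv, rfl⟩ | ⟨i, x, y, hxy, rfl⟩ | h := card_eq_three_cases hA
    · refine .inl <| .inl <| mem_powersetCard.2 ⟨fun g hg => ?_, hA⟩
      simpa using h g hg
    · obtain rfl := eq_neg_of_isMDTS_aax hn hodd huv hM
      exact .inl <| .inr <| mem_image.2 ⟨(u, x), mem_univ _, rfl⟩
    · refine .inr <| mem_image.2 ⟨(i, {x, y}), mem_product.2 ⟨?_, ?_⟩, ?_⟩
      · simpa using eq_zero_or_eq_natCast_of_isMDTS_axx hn hodd hxy hM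
      · exact mem_powersetCard.2 ⟨subset_univ _, card_pair hxy⟩
      · simp [image_insert]
    · exact absurd hM (not_isMDTS_of_forall_xa h)
  refine (Set.ncard_le_ncard hsub (finite_toSet _)).trans ?_
  rw [Set.ncard_coe_finset]
  refine (card_union_le _ _).trans (add_le_add ((card_union_le _ _).trans (add_le_add ?_ ?_)) ?_)
  · rw [card_powersetCard]
    refine Nat.choose_le_choose _ (card_image_le.trans ?_)
    simp [ZMod.card]
  · refine card_image_le.trans ?_
    simp [ZMod.card]
  · refine card_image_le.trans ?_
    rw [card_product, card_powersetCard, card_univ, ZMod.card]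
    exact Nat.mul_le_mul_right _ card_le_two

theorem le_card_sigma_compl {α : Type*} [Fintype α] [DecidableEq α] (s : Finset α)
    (t : α → Finset α) {k l : ℕ} (hs : s.card ≤ k) (ht : ∀ u, (t u).card ≤ l) :
    (Fintype.card α - k) * (Fintype.card α - l) ≤ (sᶜ.sigma fun u => (t u)ᶜ).card := by
  rw [card_sigma]
  calc (Fintype.card α - k) * (Fintype.card α - l)
      ≤ sᶜ.card * (Fintype.card α - l) :=
        Nat.mul_le_mul_right _ (by rw [card_compl]; omega)
    _ ≤ _ := by
      rw [← smul_eq_mul]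
      refine card_nsmul_le_sum _ _ _ fun u _ => ?_
      have := ht u
      rw [card_compl]
      omega

theorem card_le_two_mul_card_image {α β : Type*} [DecidableEq α] [DecidableEq β] {s : Finset α}
    {f : α → β} (g : α → α) (h : ∀ p ∈ s, ∀ q ∈ s, f p = f q → p = q ∨ p = g q) :
    s.card ≤ 2 * (s.image f).card := by
  refine card_le_mul_card_image s 2 fun b hb => ?_
  obtain ⟨q, hq, rfl⟩ := mem_image.1 hb
  refine (card_le_card (t := {q, g q}) fun p hp => ?_).trans card_le_two
  rw [mem_filter] at hp
  simpa using h p hp.1 q hq hp.2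

theorem aax_eq_aax {u v x u' v' x' : ZMod (2 * n)} (huv : u ≠ v)
    (h : ({a u, a v, xa x} : Finset (QuaternionGroup n)) = {a u', a v', xa x'}) :
    x = x' ∧ (u = u' ∧ v = v' ∨ u = v' ∧ v = u') := by
  have hx : xa x ∈ ({a u', a v', xa x'} : Finset (QuaternionGroup n)) := h ▸ by simp
  have hu : a u ∈ ({a u', a v', xa x'} : Finset (QuaternionGroup n)) := h ▸ by simp
  have hv : a v ∈ ({a u', a v', xa x'} : Finset (QuaternionGroup n)) := h ▸ by simp
  simp only [mem_insert, mem_singleton, reduceCtorEq, a.injEq, xa.injEq, or_false,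
    false_or] at hx hu hv
  grind

theorem axx_eq_axx {i x y i' x' y' : ZMod (2 * n)} (hxy : x ≠ y)
    (h : ({a i, xa x, xa y} : Finset (QuaternionGroup n)) = {a i', xa x', xa y'}) :
    i = i' ∧ (x = x' ∧ y = y' ∨ x = y' ∧ y = x') := by
  have hi : a i ∈ ({a i', xa x', xa y'} : Finset (QuaternionGroup n)) := h ▸ by simp
  have hx : xa x ∈ ({a i', xa x', xa y'} : Finset (QuaternionGroup n)) := h ▸ by simp
  have hy : xa y ∈ ({a i', xa x', xa y'} : Finset (QuaternionGroup n)) := h ▸ by simp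
  simp only [mem_insert, mem_singleton, reduceCtorEq, a.injEq, xa.injEq, or_false,
    false_or] at hi hx hy
  grind

theorem aax_ne_axx {u v x i y z : ZMod (2 * n)} (huv : u ≠ v) :
    ({a u, a v, xa x} : Finset (QuaternionGroup n)) ≠ {a i, xa y, xa z} := by
  intro h
  have hu : a u ∈ ({a i, xa y, xa z} : Finset (QuaternionGroup n)) := h ▸ by simp
  have hv : a v ∈ ({a i, xa y, xa z} : Finset (QuaternionGroup n)) := h ▸ by simp
  simp only [mem_insert, mem_singleton, reduceCtorEq, a.injEq, or_false] at hu hv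
  exact huv (hu.trans hv.symm)

theorem le_ncard_isMSTD (hn : 0 < n) (hodd : Odd n) :
    2 * n * ((2 * n - 2) * (2 * n - 6)) ≤
      {A : Finset (QuaternionGroup n) | A.card = 3 ∧ IsMSTD A}.ncard := by
  have : NeZero (2 * n) := ⟨by omega⟩
  have : NeZero n := ⟨by omega⟩
  let s : Finset (ZMod (2 * n)) := {0, (n : ZMod (2 * n))}
  let t₁ : ZMod (2 * n) → Finset (ZMod (2 * n)) := fun u =>
    {0, (n : ZMod (2 * n)), u, n + u, -u, n - u}
  let t₂ : ZMod (2 * n) → Finset (ZMod (2 * n)) := fun i =>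
    {0, (n : ZMod (2 * n)), i + i, -(i + i), n + (i + i), n - (i + i)}
  let T₁ : Finset (ZMod (2 * n) × (_ : ZMod (2 * n)) × ZMod (2 * n)) :=
    univ ×ˢ sᶜ.sigma fun u => (t₁ u)ᶜ
  let T₂ : Finset (ZMod (2 * n) × (_ : ZMod (2 * n)) × ZMod (2 * n)) :=
    univ ×ˢ sᶜ.sigma fun i => (t₂ i)ᶜ
  let f₁ : ZMod (2 * n) × (_ : ZMod (2 * n)) × ZMod (2 * n) → Finset (QuaternionGroup n) :=
    fun p => {a p.2.1, a p.2.2, xa p.1}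
  let f₂ : ZMod (2 * n) × (_ : ZMod (2 * n)) × ZMod (2 * n) → Finset (QuaternionGroup n) :=
    fun p => {a p.2.1, xa p.1, xa (p.1 + p.2.2)}
  have hT₁ : 2 * n * ((2 * n - 2) * (2 * n - 6)) ≤ T₁.card := by
    have h := le_card_sigma_compl s t₁ card_le_two fun u => card_le_six
    rw [ZMod.card] at h
    rw [card_product, card_univ, ZMod.card]
    exact Nat.mul_le_mul_left _ h
  have hT₂ : 2 * n * ((2 * n - 2) * (2 * n - 6)) ≤ T₂.card := by
    have h := le_card_sigma_compl s t₂ card_le_two fun u => card_le_six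
    rw [ZMod.card] at h
    rw [card_product, card_univ, ZMod.card]
    exact Nat.mul_le_mul_left _ h
  have mem₁ : ∀ x u v, (x, ⟨u, v⟩) ∈ T₁ → u ∉ s ∧ v ∉ t₁ u := by simp [T₁]
  have mem₂ : ∀ x i d, (x, ⟨i, d⟩) ∈ T₂ → i ∉ s ∧ d ∉ t₂ i := by simp [T₂]
  have ne₁ : ∀ {u v}, v ∉ t₁ u → u ≠ v := by
    rintro u v hv rfl
    exact hv (by simp [t₁])
  have ne₂ : ∀ {i d}, d ∉ t₂ i → d ≠ 0 := by
    rintro i d hd rfl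
    exact hd (by simp [t₂])
  have hc₁ : T₁.card ≤ 2 * (T₁.image f₁).card := by
    refine card_le_two_mul_card_image (fun p => (p.1, ⟨p.2.2, p.2.1⟩)) ?_
    rintro ⟨x, u, v⟩ hp ⟨x', u', v'⟩ - hpq
    obtain ⟨rfl, ⟨rfl, rfl⟩ | ⟨rfl, rfl⟩⟩ := aax_eq_aax (ne₁ (mem₁ _ _ _ hp).2) hpq <;> simp
  have hc₂ : T₂.card ≤ 2 * (T₂.image f₂).card := by
    refine card_le_two_mul_card_image (fun p => (p.1 + p.2.2, ⟨p.2.1, -p.2.2⟩)) ?_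
    rintro ⟨x, i, d⟩ hp ⟨x', i', d'⟩ - hpq
    have hd := ne₂ (mem₂ _ _ _ hp).2
    obtain ⟨hi, ⟨hx, h⟩ | ⟨hx, h⟩⟩ := axx_eq_axx (by simpa using hd) hpq <;>
      simp only at hi hx h <;> subst hi hx
    · left
      simpa using h
    · right
      have hd' : d = -d' := by linear_combination h
      simp [hd']
  have hdisj : Disjoint (T₁.image f₁) (T₂.image f₂) := by
    simp only [disjoint_left, mem_image, not_exists, not_and]
    rintro _ ⟨⟨x, u, v⟩, hp, rfl⟩ ⟨y, i, d⟩ - h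
    exact aax_ne_axx (ne₁ (mem₁ _ _ _ hp).2) h.symm
  have hsub : (↑(T₁.image f₁ ∪ T₂.image f₂) : Set (Finset (QuaternionGroup n))) ⊆
      {A | A.card = 3 ∧ IsMSTD A} := by
    simp only [Set.subset_def, mem_coe, mem_union, mem_image]
    rintro _ (⟨⟨x, u, v⟩, hp, rfl⟩ | ⟨⟨x, i, d⟩, hp, rfl⟩)
    · obtain ⟨hu, hv⟩ := mem₁ _ _ _ hp
      exact ⟨card_eq_three.2 ⟨_, _, _, by simpa using ne₁ hv, by simp, by simp, rfl⟩,
        isMSTD_aax hn hodd hu hv⟩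
    · obtain ⟨hi, hd⟩ := mem₂ _ _ _ hp
      exact ⟨card_eq_three.2 ⟨_, _, _, by simp, by simp, by simpa using ne₂ hd, rfl⟩,
        isMSTD_axx hn hodd hi hd⟩
  have h := Set.ncard_le_ncard hsub (Set.toFinite _)
  rw [Set.ncard_coe_finset, card_union_of_disjoint hdisj] at h
  omega

end QuaternionGroup

theorem stmt_4 (n : ℕ) (hn : 3 ≤ n) (hodd : Odd n) (hne : n ≠ 3) :
    {A : Finset (QuaternionGroup n) | A.card = 3 ∧ IsMDTS A}.ncard <
      {A : Finset (QuaternionGroup n) | A.card = 3 ∧ IsMSTD A}.ncard := by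
  have hn5 : 5 ≤ n := by
    obtain ⟨k, rfl⟩ := hodd
    omega
  refine (QuaternionGroup.ncard_isMDTS_le (by omega) hodd).trans_lt
    (lt_of_lt_of_le ?_ (QuaternionGroup.le_ncard_isMSTD (by omega) hodd))
  have h₃ := Nat.descFactorial_eq_factorial_mul_choose (2 * n) 3
  have h₂ := Nat.descFactorial_eq_factorial_mul_choose (2 * n) 2
  obtain ⟨k, rfl⟩ := Nat.exists_eq_add_of_le hn5
  simp only [Nat.descFactorial, Nat.factorial] at h₂ h₃
  have e₁ : 2 * (5 + k) - 1 = 2 * k + 9 := by omega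
  have e₂ : 2 * (5 + k) - 2 = 2 * k + 8 := by omega
  have e₆ : 2 * (5 + k) - 6 = 2 * k + 4 := by omega
  rw [e₁] at h₂ h₃
  rw [e₂] at h₃ ⊢
  rw [e₆]
  simp only [Nat.sub_zero, Nat.succ_eq_add_one, Nat.reduceAdd, Nat.reduceMul] at h₂ h₃
  nlinarith
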